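/- arXiv:1605.00001 — 3 statements merged into one kernel-verified Lean document; each statement's English description precedes it below -/
import Mathlib

section
/- For every integer Z ≥ 1, every integer X, and every N ∈ ℕ, the probability that the walk is at X after N steps and has never visited Z equals p_N(X) − p_N(Z + |X − Z|); i.e. P_N(X, 0 | Z) = p_N(X) − p_N(Z + |X − Z|) (the K = 0 case of Eq. (3.17)). -/
open Finset Filter Real

noncomputable section

/-- A walk path of length `N` is `ε : Fin N → Bool`; `true` means a `+1` step,
`false` a `-1` step. `S ε n` is the partial sum `S_n` of the first `n` steps. -/
def S {N : ℕ} (ε : Fin N → Bool) (n : ℕ) : ℤ :=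
  ∑ i ∈ Finset.univ.filter (fun i : Fin N => (i : ℕ) < n), (if ε i then (1 : ℤ) else -1)

/-- `p N X`: probability the simple symmetric random walk is at `X` after `N` steps. -/
def p (N : ℕ) (X : ℤ) : ℝ :=
  ((Finset.univ.filter (fun ε : Fin N → Bool => S ε N = X)).card : ℝ) / 2 ^ N

/-- Number of visits of the path `ε` to site `Z` at times `n ∈ {1, …, N}`. -/
def visits (N : ℕ) (Z : ℤ) (ε : Fin N → Bool) : ℕ :=
  ((Finset.Icc 1 N).filter (fun n => S ε n = Z)).card

/-- `P N X K Z`: joint probability that after `N` steps the walk is at `X`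
and has visited `Z` exactly `K` times. -/
def P (N : ℕ) (X : ℤ) (K : ℕ) (Z : ℤ) : ℝ :=
  ((Finset.univ.filter
      (fun ε : Fin N → Bool => S ε N = X ∧ visits N Z ε = K)).card : ℝ) / 2 ^ N

/-- `Pmarg N K Z`: probability of exactly `K` visits to `Z` in the first `N` steps. -/
def Pmarg (N : ℕ) (K : ℕ) (Z : ℤ) : ℝ :=
  ((Finset.univ.filter (fun ε : Fin N → Bool => visits N Z ε = K)).card : ℝ) / 2 ^ N

/-- Counting paths of length `N + 1` by their last step. -/
theorem card_filter_snoc (N : ℕ) (Q : (Fin (N + 1) → Bool) → Prop) [DecidablePred Q] :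
    (univ.filter Q).card =
      (univ.filter fun ε : Fin N → Bool => Q (Fin.snoc (α := fun _ => Bool) ε true)).card +
      (univ.filter fun ε : Fin N → Bool => Q (Fin.snoc (α := fun _ => Bool) ε false)).card := by
  simp only [card_filter]
  rw [← (Fin.snocEquiv fun _ : Fin (N + 1) => Bool).sum_comp, Fintype.sum_prod_type,
    Fintype.sum_bool]
  rfl

theorem S_snoc_of_le {N n : ℕ} (ε : Fin N → Bool) (b : Bool) (hn : n ≤ N) :
    S (Fin.snoc (α := fun _ => Bool) ε b) n = S ε n := by
  simp [S, sum_filter, Fin.sum_univ_castSucc, hn.not_gt]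

theorem S_snoc_last {N : ℕ} (ε : Fin N → Bool) (b : Bool) :
    S (Fin.snoc (α := fun _ => Bool) ε b) (N + 1) = S ε N + if b then 1 else -1 := by
  simp [S, sum_filter, Fin.sum_univ_castSucc]

theorem visits_eq_zero_iff {N : ℕ} {Z : ℤ} {ε : Fin N → Bool} :
    visits N Z ε = 0 ↔ ∀ n, 1 ≤ n → n ≤ N → S ε n ≠ Z := by
  simp [visits, filter_eq_empty_iff]

theorem visits_snoc_eq_zero_iff {N : ℕ} {Z : ℤ} {ε : Fin N → Bool} {b : Bool} :
    visits (N + 1) Z (Fin.snoc (α := fun _ => Bool) ε b) = 0 ↔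
      visits N Z ε = 0 ∧ S ε N + (if b then 1 else -1) ≠ Z := by
  simp only [visits_eq_zero_iff]
  constructor
  · intro h
    refine ⟨fun n h1 hn => ?_, ?_⟩
    · rw [← S_snoc_of_le ε b hn]
      exact h n h1 (by omega)
    · rw [← S_snoc_last]
      exact h (N + 1) (by omega) le_rfl
  · rintro ⟨h, hl⟩ n h1 hn
    rcases hn.eq_or_lt with rfl | hn
    · rwa [S_snoc_last]
    · rw [S_snoc_of_le ε b (by omega)]
      exact h n h1 (by omega)

theorem p_succ (N : ℕ) (X : ℤ) : p (N + 1) X = (p N (X - 1) + p N (X + 1)) / 2 := by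
  have h₁ (ε : Fin N → Bool) : S ε N + 1 = X ↔ S ε N = X - 1 := by omega
  have h₂ (ε : Fin N → Bool) : S ε N + -1 = X ↔ S ε N = X + 1 := by omega
  simp only [p, card_filter_snoc, S_snoc_last, if_true, Bool.false_eq_true, if_false, h₁, h₂]
  push_cast
  ring

theorem P_zero_self (N : ℕ) (Z : ℤ) : P (N + 1) Z 0 Z = 0 := by
  have h (ε : Fin (N + 1) → Bool) : ¬(S ε (N + 1) = Z ∧ visits (N + 1) Z ε = 0) :=
    fun ⟨hS, hv⟩ => visits_eq_zero_iff.1 hv _ (by omega) le_rfl hS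
  simp [P, h]

theorem P_zero_succ (N : ℕ) {X Z : ℤ} (hX : X ≠ Z) :
    P (N + 1) X 0 Z = (P N (X - 1) 0 Z + P N (X + 1) 0 Z) / 2 := by
  have h₁ (ε : Fin N → Bool) : (S ε N + 1 = X ∧ visits N Z ε = 0 ∧ S ε N + 1 ≠ Z) ↔
      (S ε N = X - 1 ∧ visits N Z ε = 0) := by omega
  have h₂ (ε : Fin N → Bool) : (S ε N + -1 = X ∧ visits N Z ε = 0 ∧ S ε N + -1 ≠ Z) ↔
      (S ε N = X + 1 ∧ visits N Z ε = 0) := by omega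
  simp only [P, card_filter_snoc, S_snoc_last, visits_snoc_eq_zero_iff, if_true,
    Bool.false_eq_true, if_false, h₁, h₂]
  push_cast
  ring

/-- The `K = 0` case of Eq. (3.17): `P_N(X, 0 | Z) = p_N(X) − p_N(Z + |X − Z|)`. -/
theorem joint_distribution_K_zero (N : ℕ) (Z X : ℤ) (hZ : 1 ≤ Z) :
    P N X 0 Z = p N X - p N (Z + |X - Z|) := by
  induction N generalizing X with
  | zero =>
    have h : (0 : ℤ) ≠ Z + |X - Z| := by positivity
    simp [P, p, S, visits, h]
  | succ N ih =>
    rcases lt_trichotomy X Z with h | rfl | h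
    · rw [P_zero_succ N h.ne, ih, ih, p_succ, p_succ, abs_of_nonpos (by omega : X - 1 - Z ≤ 0),
        abs_of_nonpos (by omega : X + 1 - Z ≤ 0), abs_of_nonpos (by omega : X - Z ≤ 0),
        show Z + -(X - 1 - Z) = Z + -(X - Z) + 1 by ring,
        show Z + -(X + 1 - Z) = Z + -(X - Z) - 1 by ring]
      ring
    · simp [P_zero_self]
    · rw [P_zero_succ N h.ne', ih, ih, abs_of_nonneg (by omega : 0 ≤ X - 1 - Z),
        abs_of_nonneg (by omega : 0 ≤ X + 1 - Z), abs_of_nonneg (by omega : 0 ≤ X - Z)]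
      simp
end
end

section
/- K-marginal (Eq. (4.5), K ≥ 1 case): for integers Z ≥ 1 and K with 1 ≤ K ≤ N, the probability 𝒫_N(K|Z) that the walk visits Z exactly K times in its first N steps satisfies 𝒫_N(K|Z) = ∑_{X ∈ ℤ} P_N(X, K | Z) = (1/2) [ p_{N−K}(Z + K − 2) + 2 p_{N−K}(Z + K − 1) + p_{N−K}(Z + K) ]. -/
open Finset Filter Real

noncomputable section

lemma card_filter_cons {N : ℕ} (Q : (Fin (N + 1) → Bool) → Prop) [DecidablePred Q] :
    (univ.filter Q).card =
      (univ.filter fun ε : Fin N → Bool => Q (Fin.cons true ε)).card +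
      (univ.filter fun ε : Fin N → Bool => Q (Fin.cons false ε)).card := by
  simp only [card_filter]
  rw [← (Fin.consEquiv fun _ : Fin (N + 1) => Bool).sum_comp, Fintype.sum_prod_type,
    Fintype.sum_bool]
  rfl

lemma S_zero_time {N : ℕ} (ε : Fin N → Bool) : S ε 0 = 0 := by simp [S]

lemma S_cons {N : ℕ} (b : Bool) (ε : Fin N → Bool) (n : ℕ) :
    S (Fin.cons b ε : Fin (N + 1) → Bool) (n + 1) = (if b then 1 else -1) + S ε n := by
  simp [S, sum_filter, Fin.sum_univ_succ]

lemma S_not {N : ℕ} (ε : Fin N → Bool) (n : ℕ) : S (fun i => !ε i) n = -S ε n := by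
  rw [S, S, ← sum_neg_distrib]
  refine sum_congr rfl fun i _ => ?_
  cases ε i <;> simp

lemma visits_not {N : ℕ} (Z : ℤ) (ε : Fin N → Bool) :
    visits N (-Z) (fun i => !ε i) = visits N Z ε := by
  simp [visits, S_not]

lemma visits_eq_sum {N : ℕ} (Z : ℤ) (ε : Fin N → Bool) :
    visits N Z ε = ∑ n ∈ range N, if S ε (n + 1) = Z then 1 else 0 := by
  rw [visits, card_filter, ← Finset.Ico_add_one_right_eq_Icc, sum_Ico_eq_sum_range]
  simp [add_comm 1]

lemma visits_le {N : ℕ} (Z : ℤ) (ε : Fin N → Bool) : visits N Z ε ≤ N :=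
  (card_filter_le _ _).trans (by simp)

lemma visits_cons {N : ℕ} (Z : ℤ) (b : Bool) (ε : Fin N → Bool) :
    visits (N + 1) Z (Fin.cons b ε) =
      (if (if b then (1 : ℤ) else -1) = Z then 1 else 0) +
        visits N (Z - if b then 1 else -1) ε := by
  rw [visits_eq_sum, visits_eq_sum, sum_range_succ', add_comm]
  simp only [S_cons, S_zero_time, add_zero, eq_sub_iff_add_eq']

/-- The number of paths of length `N` that visit `Z` exactly `K` times. -/
def visitCount (N K : ℕ) (Z : ℤ) : ℤ :=
  (univ.filter fun ε : Fin N → Bool => visits N Z ε = K).card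

/-- The number of paths of length `N` that end at `X`. -/
def endCount (N : ℕ) (X : ℤ) : ℤ :=
  (univ.filter fun ε : Fin N → Bool => S ε N = X).card

/-- The number of paths of length `N` that end at or below `X`. -/
def endLeCount (N : ℕ) (X : ℤ) : ℤ :=
  (univ.filter fun ε : Fin N → Bool => S ε N ≤ X).card

lemma endCount_zero (X : ℤ) : endCount 0 X = if X = 0 then 1 else 0 := by
  by_cases h : X = 0 <;> simp [endCount, S_zero_time, h, eq_comm]

lemma endCount_succ (N : ℕ) (X : ℤ) :
    endCount (N + 1) X = endCount N (X - 1) + endCount N (X + 1) := by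
  rw [endCount, card_filter_cons]
  simp only [S_cons, endCount, Nat.cast_add]
  congr 4 <;> ext ε <;> simp <;> omega

lemma endLeCount_zero (X : ℤ) : endLeCount 0 X = if 0 ≤ X then 1 else 0 := by
  by_cases h : 0 ≤ X <;> simp [endLeCount, S_zero_time, h]

lemma endLeCount_succ (N : ℕ) (X : ℤ) :
    endLeCount (N + 1) X = endLeCount N (X - 1) + endLeCount N (X + 1) := by
  rw [endLeCount, card_filter_cons]
  simp only [S_cons, endLeCount, Nat.cast_add]
  congr 4 <;> ext ε <;> simp <;> omega

lemma endLeCount_eq (N : ℕ) (X : ℤ) :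
    endLeCount N X = endLeCount N (X - 1) + endCount N X := by
  induction N generalizing X with
  | zero =>
    simp only [endLeCount_zero, endCount_zero]
    split_ifs <;> omega
  | succ N ih =>
    rw [endLeCount_succ, endLeCount_succ, endCount_succ, ih (X - 1), ih (X + 1),
      show X - 1 + 1 = X + 1 - 1 by ring]
    ring

lemma visitCount_zero (K : ℕ) (Z : ℤ) : visitCount 0 K Z = if K = 0 then 1 else 0 := by
  by_cases h : K = 0 <;> simp [visitCount, visits, h, eq_comm]

lemma visitCount_eq_zero {N K : ℕ} (h : N < K) (Z : ℤ) : visitCount N K Z = 0 := by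
  simp [visitCount, fun ε => ((visits_le (N := N) Z ε).trans_lt h).ne]

lemma visitCount_neg (N K : ℕ) (Z : ℤ) : visitCount N K (-Z) = visitCount N K Z := by
  have inv : Function.Involutive fun (ε : Fin N → Bool) i => !ε i := fun ε => by simp
  simp only [visitCount, card_filter]
  rw [← Equiv.sum_comp inv.toPerm]
  simp [visits_not]

lemma visitCount_succ_zero (N K : ℕ) : visitCount (N + 1) K 0 = 2 * visitCount N K 1 := by
  have h := visitCount_neg N K 1
  rw [visitCount, card_filter_cons]
  simp only [visits_cons]
  simp [visitCount] at h ⊢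
  omega

lemma visitCount_succ_one (N K : ℕ) :
    visitCount (N + 1) (K + 1) 1 = visitCount N K 0 + visitCount N (K + 1) 2 := by
  rw [visitCount, card_filter_cons]
  simp only [visits_cons]
  simp [visitCount, add_comm 1]

lemma visitCount_succ_zero_one (N : ℕ) : visitCount (N + 1) 0 1 = visitCount N 0 2 := by
  rw [visitCount, card_filter_cons]
  simp only [visits_cons]
  simp [visitCount]

lemma visitCount_succ (N K : ℕ) {Z : ℤ} (hZ : 2 ≤ Z) :
    visitCount (N + 1) K Z = visitCount N K (Z - 1) + visitCount N K (Z + 1) := by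
  rw [visitCount, card_filter_cons]
  simp only [visits_cons]
  simp [visitCount, show (1 : ℤ) ≠ Z by omega, show (-1 : ℤ) ≠ Z by omega]

/-- The reflection principle: a path avoiding `Z` ends in the interval `(-Z, Z]`, up to a
bijection. -/
lemma visitCount_zero_visits (N : ℕ) {Z : ℤ} (hZ : 1 ≤ Z) :
    visitCount N 0 Z = endLeCount N Z - endLeCount N (-Z) := by
  induction N generalizing Z with
  | zero =>
    simp only [visitCount_zero, endLeCount_zero]
    split_ifs <;> omega
  | succ N ih =>
    rw [endLeCount_succ, endLeCount_succ]
    rcases hZ.eq_or_lt with rfl | h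
    · rw [visitCount_succ_zero_one, ih (by norm_num)]
      norm_num
      ring
    · rw [visitCount_succ N 0 (by omega), ih (by omega), ih (by omega),
        show -(Z - 1) = -Z + 1 by ring, show -(Z + 1) = -Z - 1 by ring]
      ring

lemma visitCount_zero_visits_one (N : ℕ) :
    visitCount N 0 1 = endCount N 0 + endCount N 1 := by
  have h0 := endLeCount_eq N 0
  have h1 := endLeCount_eq N 1
  rw [visitCount_zero_visits N le_rfl]
  norm_num at h0 h1
  omega

lemma endCount_neg (N : ℕ) (X : ℤ) : endCount N (-X) = endCount N X := by
  induction N generalizing X with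
  | zero => simp [endCount_zero]
  | succ N ih =>
    rw [endCount_succ, endCount_succ, ← ih (X - 1), ← ih (X + 1), add_comm]
    congr 2 <;> ring

/-- The number of paths of length `K + 1 + m` that visit `Z ≥ 1` exactly `K + 1` times. -/
lemma visitCount_eq (m K : ℕ) {Z : ℤ} (hZ : 1 ≤ Z) :
    visitCount (K + 1 + m) (K + 1) Z =
      2 ^ K * (endCount m (Z + K - 1) + 2 * endCount m (Z + K) + endCount m (Z + K + 1)) := by
  induction m generalizing K Z with
  | zero =>
    rw [add_zero]
    simp only [endCount_zero]
    rcases hZ.eq_or_lt with rfl | h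
    · rw [visitCount_succ_one, visitCount_eq_zero K.lt_succ_self]
      cases K with
      | zero => simp [visitCount_zero]
      | succ K =>
        rw [visitCount_succ_zero, visitCount_eq_zero K.lt_succ_self]
        push_cast
        split_ifs <;> omega
    · rw [visitCount_succ K _ (by omega), visitCount_eq_zero K.lt_succ_self,
        visitCount_eq_zero K.lt_succ_self]
      split_ifs <;> omega
  | succ m ih =>
    simp only [endCount_succ]
    rcases hZ.eq_or_lt with rfl | h
    · rw [show K + 1 + (m + 1) = K + m + 1 + 1 by ring, visitCount_succ_one,
        visitCount_succ_zero, show K + m + 1 = K + 1 + m by ring, ih K (by norm_num)]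
      cases K with
      | zero =>
        have := endCount_neg m 1
        rw [zero_add, visitCount_zero_visits_one]
        norm_num
        linarith
      | succ K =>
        rw [ih K le_rfl]
        push_cast
        ring_nf
    · rw [← add_assoc, visitCount_succ _ _ (by omega), ih K (by omega), ih K (by omega)]
      ring_nf

/-- Eq. (4.5), `K ≥ 1` case: the visit-number marginal. -/
theorem K_marginal (N : ℕ) (Z : ℤ) (K : ℕ) (hZ : 1 ≤ Z) (hK1 : 1 ≤ K) (hKN : K ≤ N) :
    HasSum (fun X : ℤ => P N X K Z) (Pmarg N K Z) ∧
    Pmarg N K Z =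
      (1 / 2) * (p (N - K) (Z + (K : ℤ) - 2)
        + 2 * p (N - K) (Z + (K : ℤ) - 1)
        + p (N - K) (Z + (K : ℤ))) := by
  have hp (n : ℕ) (X : ℤ) : p n X = (endCount n X : ℝ) / 2 ^ n := by simp [p, endCount]
  constructor
  · have h : Pmarg N K Z =
        ∑ X ∈ univ.image fun ε : Fin N → Bool => S ε N, P N X K Z := by
      simp only [P, Pmarg, ← sum_div, ← Nat.cast_sum]
      rw [card_eq_sum_card_fiberwise (f := fun ε : Fin N → Bool => S ε N)
        (t := univ.image fun ε : Fin N → Bool => S ε N) (by intro; simp)]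
      simp only [filter_filter, and_comm]
    rw [h]
    refine hasSum_sum_of_ne_finset_zero fun X hX => ?_
    simp only [mem_image, mem_univ, true_and, not_exists] at hX
    simp [P, hX]
  · obtain ⟨k, rfl⟩ : ∃ k, K = k + 1 := ⟨K - 1, by omega⟩
    obtain ⟨m, rfl⟩ := Nat.exists_eq_add_of_le hKN
    have hv : Pmarg (k + 1 + m) (k + 1) Z =
        (visitCount (k + 1 + m) (k + 1) Z : ℝ) / 2 ^ (k + 1 + m) := by
      simp [Pmarg, visitCount]
    rw [hv, visitCount_eq m k hZ, hp, hp, hp, Nat.add_sub_cancel_left]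
    push_cast
    rw [show Z + ((k : ℤ) + 1) - 2 = Z + k - 1 by ring,
      show Z + ((k : ℤ) + 1) - 1 = Z + k by ring, ← add_assoc Z]
    field_simp
    ring
end
end

section
/- Local limit theorem (Eq. (2.7)): let x ∈ ℝ and let (X_N) be a sequence of integers with X_N ≡ N (mod 2) for every N and X_N/√N → x as N → ∞. Then √N · p_N(X_N) → √(2/π) · e^{−x²/2} as N → ∞. -/
open Finset Filter Real

noncomputable section

/-- The end point of a path is determined by its number of up-steps. -/
theorem S_self_eq {N : ℕ} (ε : Fin N → Bool) :
    S ε N = 2 * ((univ.filter fun i => ε i = true).card : ℤ) - N := by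
  have h : ∀ i : Fin N, (if ε i then (1 : ℤ) else -1) = 2 * (if ε i then 1 else 0) - 1 := by
    intro i; split_ifs <;> norm_num
  simp only [S, Fin.is_lt, filter_true]
  simp only [h, sum_sub_distrib, ← mul_sum, sum_boole]
  simp

theorem p_eq_choose (N a : ℕ) : p N (2 * a - N) = (N.choose a : ℝ) / 2 ^ N := by
  have h : (univ.filter fun ε : Fin N → Bool => S ε N = 2 * a - N).card = N.choose a := by
    rw [← Fintype.card_fin N, ← card_univ, ← card_powersetCard, card_univ, Fintype.card_fin]
    refine card_nbij' (fun ε => univ.filter fun i => ε i = true) (fun s i => decide (i ∈ s))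
      ?_ ?_ ?_ ?_
    · intro ε hε
      simp only [S_self_eq, coe_filter, mem_univ, true_and, Set.mem_ofPred_eq] at hε
      simp only [mem_coe, mem_powersetCard, subset_univ, true_and]
      omega
    · intro s hs
      simp only [mem_coe, mem_powersetCard, subset_univ, true_and] at hs
      simp [S_self_eq, hs]
    · intro ε _
      ext i
      simp
    · intro s _
      ext i
      simp
  rw [p, h]

theorem abs_entropy_sub_sq_le {u : ℝ} (hu : |u| ≤ 1 / 2) :
    |(1 + u) * log (1 + u) + (1 - u) * log (1 - u) - u ^ 2| ≤ 4 * |u| ^ 3 := by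
  have key : ∀ v : ℝ, |v| ≤ 1 / 2 → |v + v ^ 2 / 2 + log (1 - v)| ≤ 2 * |v| ^ 3 := by
    intro v hv
    have h := abs_log_sub_add_sum_range_le (show |v| < 1 by linarith) 2
    norm_num [sum_range_succ] at h
    refine h.trans ?_
    rw [div_le_iff₀ (by linarith)]
    nlinarith [pow_nonneg (abs_nonneg v) 3]
  have h₁ := key u hu
  have h₂ := key (-u) (by rwa [abs_neg])
  rw [abs_neg, sub_neg_eq_add] at h₂
  obtain ⟨hl, hr⟩ := abs_le.1 hu
  have e : (1 + u) * log (1 + u) + (1 - u) * log (1 - u) - u ^ 2 =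
      (1 + u) * (-u + (-u) ^ 2 / 2 + log (1 + u)) + (1 - u) * (u + u ^ 2 / 2 + log (1 - u)) := by
    ring
  rw [e]
  refine (abs_add_le _ _).trans ?_
  rw [abs_mul, abs_mul, abs_of_pos (show 0 < 1 + u by linarith),
    abs_of_pos (show 0 < 1 - u by linarith)]
  nlinarith [mul_le_mul_of_nonneg_left h₂ (show 0 ≤ 1 + u by linarith),
    mul_le_mul_of_nonneg_left h₁ (show 0 ≤ 1 - u by linarith)]

theorem factorial_eq_stirlingSeq_mul {n : ℕ} (hn : 0 < n) :
    (n.factorial : ℝ) = Stirling.stirlingSeq n * √(2 * n) * exp (n * log n - n) := by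
  have hn' : (0 : ℝ) < n := by exact_mod_cast hn
  have h : exp (n * log n - n) = (n / exp 1) ^ n := by
    rw [← exp_log (show 0 < (n : ℝ) / exp 1 by positivity), ← exp_nat_mul,
      log_div hn'.ne' (exp_pos 1).ne', log_exp]
    ring_nf
  rw [h, Stirling.stirlingSeq]
  field_simp

theorem sqrt_mul_choose_div_two_pow {a b : ℕ} {u : ℝ} (ha : 0 < a) (hb : 0 < b)
    (hau : (a : ℝ) = (a + b : ℕ) * (1 + u) / 2) (hbu : (b : ℝ) = (a + b : ℕ) * (1 - u) / 2) :
    √(a + b : ℕ) * (((a + b).choose a : ℝ) / 2 ^ (a + b)) =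
      Stirling.stirlingSeq (a + b) / (Stirling.stirlingSeq a * Stirling.stirlingSeq b) *
        (√2 / √(1 - u ^ 2)) *
        exp (-((a + b : ℕ) * ((1 + u) * log (1 + u) + (1 - u) * log (1 - u)) / 2)) := by
  have ha' : (0 : ℝ) < a := by exact_mod_cast ha
  have hb' : (0 : ℝ) < b := by exact_mod_cast hb
  rw [Nat.choose_symm_add, Nat.add_choose, Nat.cast_div (Nat.factorial_mul_factorial_dvd_factorial_add a b)
    (by positivity), Nat.cast_mul, factorial_eq_stirlingSeq_mul ha,
    factorial_eq_stirlingSeq_mul hb, factorial_eq_stirlingSeq_mul (Nat.add_pos_left ha b)]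
  have hN : ((a + b : ℕ) : ℝ) = a + b := Nat.cast_add a b
  have hpow : (2 : ℝ) ^ (a + b) = exp ((a + b : ℕ) * log 2) := by
    rw [exp_nat_mul, exp_log two_pos]
  rw [hpow]
  generalize ((a + b : ℕ) : ℝ) = n at *
  have hn : 0 < n := by linarith
  have hu₁ : 0 < 1 + u := by
    by_contra! h
    nlinarith
  have hu₂ : 0 < 1 - u := by
    by_contra! h
    nlinarith
  have hsq : √(2 * a) * √(2 * b) = n * √(1 - u ^ 2) := by
    rw [← sqrt_mul (by positivity), show 2 * (a : ℝ) * (2 * b) = n ^ 2 * (1 - u ^ 2) by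
      rw [hau, hbu]; ring, sqrt_mul (by positivity), sqrt_sq hn.le]
  have hsn : √n * √(2 * n) = √2 * n := by
    rw [sqrt_mul two_pos.le, mul_left_comm, mul_self_sqrt hn.le]
  have hla : log a = log n + log (1 + u) - log 2 := by
    rw [hau, log_div (by positivity) two_ne_zero, log_mul hn.ne' hu₁.ne']
  have hlb : log b = log n + log (1 - u) - log 2 := by
    rw [hbu, log_div (by positivity) two_ne_zero, log_mul hn.ne' hu₂.ne']
  have hexp : exp (n * log n - n) =
      exp (-(n * ((1 + u) * log (1 + u) + (1 - u) * log (1 - u)) / 2)) *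
        (exp (a * log a - a) * exp (b * log b - b) * exp (n * log 2)) := by
    simp only [← exp_add]
    rw [hla, hlb, hau, hbu]
    ring_nf
  calc
    _ = Stirling.stirlingSeq (a + b) / (Stirling.stirlingSeq a * Stirling.stirlingSeq b) *
        ((√n * √(2 * n)) / (√(2 * a) * √(2 * b))) *
        (exp (n * log n - n) /
          (exp (a * log a - a) * exp (b * log b - b) * exp (n * log 2))) := by
      simp only [div_eq_mul_inv, mul_inv]
      ring
    _ = _ := by
      rw [hsq, hsn, hexp, mul_div_cancel_right₀ _ (by positivity), mul_comm √2 n,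
        mul_div_mul_left _ _ hn.ne']

theorem tendsto_mul_entropy {x : ℝ} {u : ℕ → ℝ}
    (hu : Tendsto (fun N : ℕ => √N * u N) atTop (nhds x)) (hu₀ : Tendsto u atTop (nhds 0)) :
    Tendsto (fun N : ℕ =>
      (N : ℝ) * ((1 + u N) * log (1 + u N) + (1 - u N) * log (1 - u N)) / 2)
      atTop (nhds (x ^ 2 / 2)) := by
  have hsq : Tendsto (fun N : ℕ => (N : ℝ) * u N ^ 2) atTop (nhds (x ^ 2)) := by
    refine (hu.pow 2).congr fun N => ?_
    rw [mul_pow, sq_sqrt N.cast_nonneg]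
  have hbd : Tendsto (fun N : ℕ => 4 * ((N : ℝ) * u N ^ 2 * |u N|)) atTop (nhds 0) := by
    simpa using (hsq.mul hu₀.abs).const_mul 4
  have hdiff : Tendsto (fun N : ℕ => (N : ℝ) *
      ((1 + u N) * log (1 + u N) + (1 - u N) * log (1 - u N) - u N ^ 2)) atTop (nhds 0) := by
    refine squeeze_zero_norm' ?_ hbd
    have hsmall : ∀ᶠ N in atTop, |u N| < 1 / 2 := by
      have := hu₀.abs
      rw [abs_zero] at this
      exact this.eventually_lt_const (by norm_num)
    filter_upwards [hsmall] with N hN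
    rw [norm_mul, norm_of_nonneg N.cast_nonneg, norm_eq_abs]
    refine (mul_le_mul_of_nonneg_left (abs_entropy_sub_sq_le hN.le) N.cast_nonneg).trans_eq ?_
    rw [← sq_abs (u N)]
    ring
  have h := (hdiff.add hsq).div_const 2
  rw [zero_add] at h
  exact h.congr fun N => by ring

/-- Eq. (2.7): the local limit theorem for the simple symmetric random walk. -/
theorem local_limit (x : ℝ) (X : ℕ → ℤ)
    (hpar : ∀ N : ℕ, X N % 2 = (N : ℤ) % 2)
    (hx : Tendsto (fun N : ℕ => (X N : ℝ) / Real.sqrt N) atTop (nhds x)) :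
    Tendsto (fun N : ℕ => Real.sqrt N * p N (X N)) atTop
      (nhds (Real.sqrt (2 / Real.pi) * Real.exp (-x ^ 2 / 2))) := by
  set u : ℕ → ℝ := fun N => (X N : ℝ) / N with hu_def
  have hinv : Tendsto (fun N : ℕ => (√(N : ℝ))⁻¹) atTop (nhds 0) :=
    tendsto_inv_atTop_zero.comp (tendsto_sqrt_atTop.comp tendsto_natCast_atTop_atTop)
  have hu₀ : Tendsto u atTop (nhds 0) := by
    have h := hx.mul hinv
    rw [mul_zero] at h
    refine h.congr fun N => ?_
    rw [hu_def, ← div_eq_mul_inv, div_div, mul_self_sqrt N.cast_nonneg]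
  have hu : Tendsto (fun N : ℕ => √N * u N) atTop (nhds x) := by
    refine hx.congr' ?_
    filter_upwards [eventually_gt_atTop 0] with N hN
    have hN' : (0 : ℝ) < N := by exact_mod_cast hN
    rw [hu_def, div_eq_iff (sqrt_pos.2 hN').ne', mul_right_comm, mul_self_sqrt hN'.le]
    field_simp
  set a : ℕ → ℕ := fun N => ((N + X N) / 2).toNat with ha_def
  set b : ℕ → ℕ := fun N => ((N - X N) / 2).toNat with hb_def
  have hab : ∀ᶠ N : ℕ in atTop, (N : ℝ) / 4 ≤ a N ∧ (N : ℝ) / 4 ≤ b N ∧ 0 < a N ∧ 0 < b N ∧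
      a N + b N = N ∧ X N = 2 * a N - N ∧
      (a N : ℝ) = N * (1 + u N) / 2 ∧ (b N : ℝ) = N * (1 - u N) / 2 := by
    have hsmall : ∀ᶠ N in atTop, |u N| < 1 / 2 := by
      have := hu₀.abs
      rw [abs_zero] at this
      exact this.eventually_lt_const (by norm_num)
    filter_upwards [hsmall, eventually_gt_atTop 0] with N hN hpos
    have hN' : (0 : ℝ) < N := by exact_mod_cast hpos
    obtain ⟨hl, hr⟩ := abs_lt.1 hN
    have hXu : (X N : ℝ) = N * u N := by
      rw [hu_def]; field_simp
    have h₁ : -(N : ℤ) < X N := by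
      have : (-(N : ℝ)) < X N := by rw [hXu]; nlinarith
      exact_mod_cast this
    have h₂ : X N < N := by
      have : (X N : ℝ) < N := by rw [hXu]; nlinarith
      exact_mod_cast this
    have hp := hpar N
    have ha : 2 * (a N : ℤ) = N + X N := by simp only [ha_def]; omega
    have hb : 2 * (b N : ℤ) = N - X N := by simp only [hb_def]; omega
    have ha' : 2 * (a N : ℝ) = N + X N := by exact_mod_cast ha
    have hb' : 2 * (b N : ℝ) = N - X N := by exact_mod_cast hb
    refine ⟨by nlinarith, by nlinarith, by omega, by omega, by omega, by omega,
      by linarith, by linarith⟩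
  have hquarter : Tendsto (fun N : ℕ => (N : ℝ) / 4) atTop atTop :=
    tendsto_natCast_atTop_atTop.atTop_div_const (by norm_num)
  have ha : Tendsto a atTop atTop := tendsto_natCast_atTop_iff.1
    (tendsto_atTop_mono' _ (hab.mono fun N h => h.1) hquarter)
  have hb : Tendsto b atTop atTop := tendsto_natCast_atTop_iff.1
    (tendsto_atTop_mono' _ (hab.mono fun N h => h.2.1) hquarter)
  have hs := Stirling.tendsto_stirlingSeq_sqrt_pi
  have hπ : √π ≠ 0 := (sqrt_pos.2 pi_pos).ne'
  have hratio := hs.div ((hs.comp ha).mul (hs.comp hb)) (mul_ne_zero hπ hπ)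
  have hroot : Tendsto (fun N => √2 / √(1 - u N ^ 2)) atTop (nhds √2) := by
    have h : Tendsto (fun N => √(1 - u N ^ 2)) atTop (nhds 1) := by
      simpa using ((hu₀.pow 2).const_sub 1).sqrt
    have h' := (tendsto_const_nhds (x := √2)).div h one_ne_zero
    rwa [div_one] at h'
  have hexp := (continuous_exp.tendsto _).comp (tendsto_mul_entropy hu hu₀).neg
  have hlim : √(2 / π) * exp (-x ^ 2 / 2) = √π / (√π * √π) * √2 * exp (-(x ^ 2 / 2)) := by
    rw [sqrt_div two_pos.le, neg_div]
    field_simp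
  rw [hlim]
  refine ((hratio.mul hroot).mul hexp).congr' ?_
  filter_upwards [hab] with N h
  obtain ⟨-, -, ha₀, hb₀, hN, hX, hau, hbu⟩ := h
  have key := sqrt_mul_choose_div_two_pow (u := u N) ha₀ hb₀ (by rwa [hN]) (by rwa [hN])
  rw [hN] at key
  rw [hX, p_eq_choose, key]
  rfl
end
end
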